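/- Let z : ℝ³ → ℂ² be a smooth 2-vector function of (t, ξ, η) satisfying z_ξ = i·z_tt (componentwise), and define the real functions α = (i/2)·(z ∨ z̄), β = (1/2)·(z_t ∨ z̄ − z ∨ z̄_t), γ = −(i/2)·(z_tt ∨ z̄ − 2·z_t ∨ z̄_t + z ∨ z̄_tt), δ = −(1/2)·(z_ttt ∨ z̄ − 3·z_tt ∨ z̄_t + 3·z_t ∨ z̄_tt − z ∨ z̄_ttt), where ∨ is the skew form a ∨ b = a¹b² − a²b¹ and z̄ the componentwise conjugate. Then α_ξ + β_t = 0, β_ξ + γ_t = 0, and γ_ξ + δ_t = 0. -/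

import Mathlib

/-- skew form on ℂ² -/
noncomputable def wedge (a b : ℂ × ℂ) : ℂ := a.1 * b.2 - a.2 * b.1

/-- componentwise conjugate -/
noncomputable def conj2 (a : ℂ × ℂ) : ℂ × ℂ := (starRingEnd ℂ a.1, starRingEnd ℂ a.2)

/-- partial derivative in `t` -/
noncomputable def pt (f : ℝ → ℝ → ℝ → ℂ × ℂ) : ℝ → ℝ → ℝ → ℂ × ℂ :=
  fun t ξ η => deriv (fun s => f s ξ η) t

/-- partial derivative in `ξ` -/
noncomputable def px (f : ℝ → ℝ → ℝ → ℂ × ℂ) : ℝ → ℝ → ℝ → ℂ × ℂ :=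
  fun t ξ η => deriv (fun s => f t s η) ξ

/-- partial scalar derivatives for complex-valued functions -/
noncomputable def spt (f : ℝ → ℝ → ℝ → ℂ) : ℝ → ℝ → ℝ → ℂ :=
  fun t ξ η => deriv (fun s => f s ξ η) t

noncomputable def spx (f : ℝ → ℝ → ℝ → ℂ) : ℝ → ℝ → ℝ → ℂ :=
  fun t ξ η => deriv (fun s => f t s η) ξ

theorem hasDerivAt_t_of_contDiff {f : ℝ → ℝ → ℝ → ℂ × ℂ}
    (hf : ContDiff ℝ (⊤ : ℕ∞) (fun p : ℝ × ℝ × ℝ => f p.1 p.2.1 p.2.2)) (t ξ η : ℝ) :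
    HasDerivAt (fun s => f s ξ η)
      (fderiv ℝ (fun p : ℝ × ℝ × ℝ => f p.1 p.2.1 p.2.2) (t, ξ, η) (1, 0, 0)) t := by
  have hF := ((hf.differentiable (by simp)) (t, ξ, η)).hasFDerivAt
  have hline : HasDerivAt (fun s : ℝ => (s, ξ, η)) (1, 0, 0) t :=
    (hasDerivAt_id t).prodMk ((hasDerivAt_const t ξ).prodMk (hasDerivAt_const t η))
  exact hF.comp_hasDerivAt t hline

theorem hasDerivAt_ξ_of_contDiff {f : ℝ → ℝ → ℝ → ℂ × ℂ}
    (hf : ContDiff ℝ (⊤ : ℕ∞) (fun p : ℝ × ℝ × ℝ => f p.1 p.2.1 p.2.2)) (t ξ η : ℝ) :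
    HasDerivAt (fun s => f t s η)
      (fderiv ℝ (fun p : ℝ × ℝ × ℝ => f p.1 p.2.1 p.2.2) (t, ξ, η) (0, 1, 0)) ξ := by
  have hF := ((hf.differentiable (by simp)) (t, ξ, η)).hasFDerivAt
  have hline : HasDerivAt (fun s : ℝ => (t, s, η)) (0, 1, 0) ξ :=
    (hasDerivAt_const ξ t).prodMk ((hasDerivAt_id ξ).prodMk (hasDerivAt_const ξ η))
  exact hF.comp_hasDerivAt ξ hline

theorem hasDerivAt_pt {f : ℝ → ℝ → ℝ → ℂ × ℂ}
    (hf : ContDiff ℝ (⊤ : ℕ∞) (fun p : ℝ × ℝ × ℝ => f p.1 p.2.1 p.2.2)) (t ξ η : ℝ) :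
    HasDerivAt (fun s => f s ξ η) (pt f t ξ η) t :=
  (hasDerivAt_t_of_contDiff hf t ξ η).differentiableAt.hasDerivAt

theorem hasDerivAt_px {f : ℝ → ℝ → ℝ → ℂ × ℂ}
    (hf : ContDiff ℝ (⊤ : ℕ∞) (fun p : ℝ × ℝ × ℝ => f p.1 p.2.1 p.2.2)) (t ξ η : ℝ) :
    HasDerivAt (fun s => f t s η) (px f t ξ η) ξ :=
  (hasDerivAt_ξ_of_contDiff hf t ξ η).differentiableAt.hasDerivAt

theorem uncurry_pt_eq_fderiv {f : ℝ → ℝ → ℝ → ℂ × ℂ}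
    (hf : ContDiff ℝ (⊤ : ℕ∞) (fun p : ℝ × ℝ × ℝ => f p.1 p.2.1 p.2.2)) :
    (fun p : ℝ × ℝ × ℝ => pt f p.1 p.2.1 p.2.2) =
      fun p => fderiv ℝ (fun p : ℝ × ℝ × ℝ => f p.1 p.2.1 p.2.2) p (1, 0, 0) :=
  funext fun p => (hasDerivAt_t_of_contDiff hf p.1 p.2.1 p.2.2).deriv

theorem uncurry_px_eq_fderiv {f : ℝ → ℝ → ℝ → ℂ × ℂ}
    (hf : ContDiff ℝ (⊤ : ℕ∞) (fun p : ℝ × ℝ × ℝ => f p.1 p.2.1 p.2.2)) :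
    (fun p : ℝ × ℝ × ℝ => px f p.1 p.2.1 p.2.2) =
      fun p => fderiv ℝ (fun p : ℝ × ℝ × ℝ => f p.1 p.2.1 p.2.2) p (0, 1, 0) :=
  funext fun p => (hasDerivAt_ξ_of_contDiff hf p.1 p.2.1 p.2.2).deriv

theorem contDiff_pt {f : ℝ → ℝ → ℝ → ℂ × ℂ}
    (hf : ContDiff ℝ (⊤ : ℕ∞) (fun p : ℝ × ℝ × ℝ => f p.1 p.2.1 p.2.2)) :
    ContDiff ℝ (⊤ : ℕ∞) (fun p : ℝ × ℝ × ℝ => pt f p.1 p.2.1 p.2.2) := by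
  rw [uncurry_pt_eq_fderiv hf]
  exact (hf.fderiv_right (by simp)).clm_apply contDiff_const

theorem contDiff_px {f : ℝ → ℝ → ℝ → ℂ × ℂ}
    (hf : ContDiff ℝ (⊤ : ℕ∞) (fun p : ℝ × ℝ × ℝ => f p.1 p.2.1 p.2.2)) :
    ContDiff ℝ (⊤ : ℕ∞) (fun p : ℝ × ℝ × ℝ => px f p.1 p.2.1 p.2.2) := by
  rw [uncurry_px_eq_fderiv hf]
  exact (hf.fderiv_right (by simp)).clm_apply contDiff_const

theorem px_pt_comm {f : ℝ → ℝ → ℝ → ℂ × ℂ}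
    (hf : ContDiff ℝ (⊤ : ℕ∞) (fun p : ℝ × ℝ × ℝ => f p.1 p.2.1 p.2.2)) (t ξ η : ℝ) :
    px (pt f) t ξ η = pt (px f) t ξ η := by
  have hd : DifferentiableAt ℝ (fderiv ℝ (fun p : ℝ × ℝ × ℝ => f p.1 p.2.1 p.2.2)) (t, ξ, η) :=
    (hf.fderiv_right (m := (⊤ : ℕ∞)) (by simp)).differentiable (by simp) _
  have hsymm : IsSymmSndFDerivAt ℝ (fun p : ℝ × ℝ × ℝ => f p.1 p.2.1 p.2.2) (t, ξ, η) :=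
    hf.contDiffAt.isSymmSndFDerivAt (by
      rw [minSmoothness_of_isRCLikeNormedField]
      exact WithTop.coe_le_coe.2 (le_top : (2 : ℕ∞) ≤ ⊤))
  have h1 : px (pt f) t ξ η = _ := (hasDerivAt_ξ_of_contDiff (contDiff_pt hf) t ξ η).deriv
  have h2 : pt (px f) t ξ η = _ := (hasDerivAt_t_of_contDiff (contDiff_px hf) t ξ η).deriv
  rw [h1, h2, uncurry_pt_eq_fderiv hf, uncurry_px_eq_fderiv hf,
    fderiv_clm_apply hd (differentiableAt_const _), fderiv_clm_apply hd (differentiableAt_const _)]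
  simpa using hsymm (0, 1, 0) (1, 0, 0)

theorem px_pt_eq_smul_pt {f g : ℝ → ℝ → ℝ → ℂ × ℂ} {c : ℂ}
    (hf : ContDiff ℝ (⊤ : ℕ∞) (fun p : ℝ × ℝ × ℝ => f p.1 p.2.1 p.2.2))
    (hg : ContDiff ℝ (⊤ : ℕ∞) (fun p : ℝ × ℝ × ℝ => g p.1 p.2.1 p.2.2))
    (hfg : ∀ t ξ η, px f t ξ η = c • g t ξ η) (t ξ η : ℝ) :
    px (pt f) t ξ η = c • pt g t ξ η := by
  rw [px_pt_comm hf]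
  have h : px f = fun t ξ η => c • g t ξ η := by
    funext t ξ η
    exact hfg t ξ η
  rw [h]
  exact ((hasDerivAt_pt hg t ξ η).const_smul c).deriv

theorem HasDerivAt.wedge_conj2 {u v : ℝ → ℂ × ℂ} {u' v' : ℂ × ℂ} {x : ℝ}
    (hu : HasDerivAt u u' x) (hv : HasDerivAt v v' x) :
    HasDerivAt (fun s => wedge (u s) (conj2 (v s)))
      (wedge u' (conj2 (v x)) + wedge (u x) (conj2 v')) x := by
  have hu1 : HasDerivAt (fun s => (u s).1) u'.1 x :=
    (ContinuousLinearMap.fst ℝ ℂ ℂ).hasFDerivAt.comp_hasDerivAt x hu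
  have hu2 : HasDerivAt (fun s => (u s).2) u'.2 x :=
    (ContinuousLinearMap.snd ℝ ℂ ℂ).hasFDerivAt.comp_hasDerivAt x hu
  have hv1 : HasDerivAt (fun s => starRingEnd ℂ (v s).1) (starRingEnd ℂ v'.1) x :=
    ((Complex.conjCLE : ℂ →L[ℝ] ℂ).comp
      (ContinuousLinearMap.fst ℝ ℂ ℂ)).hasFDerivAt.comp_hasDerivAt x hv
  have hv2 : HasDerivAt (fun s => starRingEnd ℂ (v s).2) (starRingEnd ℂ v'.2) x :=
    ((Complex.conjCLE : ℂ →L[ℝ] ℂ).comp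
      (ContinuousLinearMap.snd ℝ ℂ ℂ)).hasFDerivAt.comp_hasDerivAt x hv
  refine ((hu1.mul hv2).sub (hu2.mul hv1)).congr_deriv ?_
  simp only [wedge, conj2]
  ring

theorem wedge_smul_left (c : ℂ) (a b : ℂ × ℂ) : wedge (c • a) b = c * wedge a b := by
  simp only [wedge, Prod.smul_fst, Prod.smul_snd, smul_eq_mul]
  ring

theorem wedge_conj2_smul (c : ℂ) (a b : ℂ × ℂ) :
    wedge a (conj2 (c • b)) = starRingEnd ℂ c * wedge a (conj2 b) := by
  simp only [wedge, conj2, Prod.smul_fst, Prod.smul_snd, smul_eq_mul, map_mul]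
  ring

theorem conservation_chain (z : ℝ → ℝ → ℝ → ℂ × ℂ)
    (hz : ContDiff ℝ (⊤ : ℕ∞) (fun p : ℝ × ℝ × ℝ => z p.1 p.2.1 p.2.2))
    (heq : ∀ t ξ η, px z t ξ η = Complex.I • pt (pt z) t ξ η) :
    let α : ℝ → ℝ → ℝ → ℂ := fun t ξ η =>
      (Complex.I / 2) * wedge (z t ξ η) (conj2 (z t ξ η))
    let β : ℝ → ℝ → ℝ → ℂ := fun t ξ η =>
      (1 / 2 : ℂ) * (wedge (pt z t ξ η) (conj2 (z t ξ η))
        - wedge (z t ξ η) (conj2 (pt z t ξ η)))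
    let γ : ℝ → ℝ → ℝ → ℂ := fun t ξ η =>
      -(Complex.I / 2) * (wedge (pt (pt z) t ξ η) (conj2 (z t ξ η))
        - 2 * wedge (pt z t ξ η) (conj2 (pt z t ξ η))
        + wedge (z t ξ η) (conj2 (pt (pt z) t ξ η)))
    let δ : ℝ → ℝ → ℝ → ℂ := fun t ξ η =>
      -(1 / 2 : ℂ) * (wedge (pt (pt (pt z)) t ξ η) (conj2 (z t ξ η))
        - 3 * wedge (pt (pt z) t ξ η) (conj2 (pt z t ξ η))
        + 3 * wedge (pt z t ξ η) (conj2 (pt (pt z) t ξ η))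
        - wedge (z t ξ η) (conj2 (pt (pt (pt z)) t ξ η)))
    ∀ t ξ η,
      spx α t ξ η + spt β t ξ η = 0 ∧
      spx β t ξ η + spt γ t ξ η = 0 ∧
      spx γ t ξ η + spt δ t ξ η = 0 := by
  intro α β γ δ t ξ η
  have hz1 := contDiff_pt hz
  have hz2 := contDiff_pt hz1
  have hz3 := contDiff_pt hz2
  have heq1 := px_pt_eq_smul_pt hz hz2 heq
  have heq2 := px_pt_eq_smul_pt hz1 hz3 heq1
  have t0 := hasDerivAt_pt hz t ξ η
  have t1 := hasDerivAt_pt hz1 t ξ η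
  have t2 := hasDerivAt_pt hz2 t ξ η
  have t3 := hasDerivAt_pt hz3 t ξ η
  have x0 := hasDerivAt_px hz t ξ η
  have x1 := hasDerivAt_px hz1 t ξ η
  have x2 := hasDerivAt_px hz2 t ξ η
  rw [heq] at x0
  rw [heq1] at x1
  rw [heq2] at x2
  have hαξ : spx α t ξ η = _ := ((x0.wedge_conj2 x0).const_mul (Complex.I / 2)).deriv
  have hβt : spt β t ξ η = _ :=
    (((t1.wedge_conj2 t0).sub (t0.wedge_conj2 t1)).const_mul (1 / 2 : ℂ)).deriv
  have hβξ : spx β t ξ η = _ :=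
    (((x1.wedge_conj2 x0).sub (x0.wedge_conj2 x1)).const_mul (1 / 2 : ℂ)).deriv
  have hγt : spt γ t ξ η = _ :=
    ((((t2.wedge_conj2 t0).sub ((t1.wedge_conj2 t1).const_mul 2)).add
      (t0.wedge_conj2 t2)).const_mul (-(Complex.I / 2))).deriv
  have hγξ : spx γ t ξ η = _ :=
    ((((x2.wedge_conj2 x0).sub ((x1.wedge_conj2 x1).const_mul 2)).add
      (x0.wedge_conj2 x2)).const_mul (-(Complex.I / 2))).deriv
  have hδt : spt δ t ξ η = _ :=
    (((((t3.wedge_conj2 t0).sub ((t2.wedge_conj2 t1).const_mul 3)).add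
      ((t1.wedge_conj2 t2).const_mul 3)).sub (t0.wedge_conj2 t3)).const_mul (-(1 / 2 : ℂ))).deriv
  rw [hαξ, hβt, hβξ, hγt, hγξ, hδt]
  simp only [wedge_smul_left, wedge_conj2_smul, Complex.conj_I]
  refine ⟨?_, ?_, ?_⟩ <;> ring_nf <;> simp only [Complex.I_sq] <;> ring
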